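/- arXiv:1608.00284 — 7 statements merged into one kernel-verified Lean document; each statement's English description precedes it below -/
import Mathlib

section
/- Let q : Λ → A be a quadratic form with polar form b, let α ∈ Λ and α̌ : Λ →ₗ[ℤ] ℤ satisfy α̌(α) = 2, and suppose q is s_α-invariant. Then for every λ ∈ Λ one has 2•b(α,λ) = 2•(α̌(λ)•q(α)); that is, the restricted condition at (α,α̌) always holds after multiplication by 2. -/
/-- For a quadratic form `q : Λ → A` with polar form `b`, a pair `(α, av)`
with `av α = 2`, and `q` invariant under the reflection `s_α (λ) = λ - av λ • α`,
one has `2 • b(α,λ) = 2 • (av λ • q α)` for all `λ`. -/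
theorem two_smul_polar_eq_of_reflection_invariant
    {Λ A : Type*} [AddCommGroup Λ] [AddCommGroup A]
    (q : QuadraticMap ℤ Λ A) (α : Λ) (av : Λ →ₗ[ℤ] ℤ) (hav : av α = 2)
    (hinv : ∀ l : Λ, q (l - av l • α) = q l) :
    ∀ l : Λ, (2 : ℤ) • QuadraticMap.polar ⇑q α l = (2 : ℤ) • (av l • q α) := by
  intro l
  have h_inv : QuadraticMap.polar q (-α) (l - av l • α) = QuadraticMap.polar q α l := by
    have h_add : -α + (l - av l • α) = (α + l) - av (α + l) • α := by
      rw [map_add, hav]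
      module
    rw [QuadraticMap.polar, h_add, hinv, hinv, QuadraticMap.map_neg, QuadraticMap.polar]
  rw [QuadraticMap.polar_neg_left, QuadraticMap.polar_sub_right, QuadraticMap.polar_smul_right,
    QuadraticMap.polar_self] at h_inv
  rw [two_smul ℤ (QuadraticMap.polar q α l)]
  nth_rewrite 1 [← h_inv]
  module
end

section
/- Let q : Λ → A be a quadratic form with polar form b, let α ∈ Λ and α̌ : Λ →ₗ[ℤ] ℤ satisfy α̌(α) = 2, and suppose q is s_α-invariant. If moreover α = 2•α' for some α' ∈ Λ, then the restricted condition at (α,α̌) holds automatically: b(α,λ) = α̌(λ)•q(α) for all λ ∈ Λ. -/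
/-- A quadratic map invariant under the translation `m ↦ m - a` at `m` satisfies
`polar q a m = q a`. -/
theorem QuadraticMap.polar_eq_of_map_sub_eq {R M N : Type*} [CommRing R] [AddCommGroup M]
    [AddCommGroup N] [Module R M] [Module R N] (q : QuadraticMap R M N) {a m : M}
    (h : q (m - a) = q m) : QuadraticMap.polar q a m = q a := by
  have h₁ := QuadraticMap.map_add q (m - a) a
  rw [sub_add_cancel, h, QuadraticMap.polar_sub_left, QuadraticMap.polar_self,
    QuadraticMap.polar_comm q m a, two_smul] at h₁
  have h₂ : QuadraticMap.polar q a m - q a = 0 := by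
    calc QuadraticMap.polar q a m - q a
        = (q m + q a + (QuadraticMap.polar q a m - (q a + q a))) - q m := by abel
      _ = 0 := by rw [← h₁, sub_self]
  exact sub_eq_zero.mp h₂

/-- For a quadratic form `q : Λ → A` with polar form `b`, a pair `(α, av)`
with `av α = 2`, and `q` invariant under the reflection `s_α (λ) = λ - av λ • α`,
if moreover `α = 2 • α'` for some `α' ∈ Λ`, then the restricted condition holds:
`b(α,λ) = av λ • q α` for all `λ`. -/
theorem restricted_condition_of_reflection_invariant_of_half
    {Λ A : Type*} [AddCommGroup Λ] [AddCommGroup A]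
    (q : QuadraticMap ℤ Λ A) (α : Λ) (av : Λ →ₗ[ℤ] ℤ) (hav : av α = 2)
    (hinv : ∀ l : Λ, q (l - av l • α) = q l)
    (α' : Λ) (hα' : α = (2 : ℤ) • α') :
    ∀ l : Λ, QuadraticMap.polar ⇑q α l = av l • q α := by
  intro l
  have hα'_one : av α' = 1 := by
    rw [hα', map_smul, smul_eq_mul] at hav
    omega
  have key (m : Λ) (hm : av m = 1) : QuadraticMap.polar q α m = q α :=
    q.polar_eq_of_map_sub_eq (by simpa [hm] using hinv m)
  have h := key (l + (1 - av l) • α') (by simp [hα'_one])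
  rw [QuadraticMap.polar_add_right, QuadraticMap.polar_smul_right, key α' hα'_one,
    sub_smul, one_smul] at h
  calc QuadraticMap.polar q α l
      = (QuadraticMap.polar q α l + (q α - av l • q α)) - q α + av l • q α := by abel
    _ = av l • q α := by rw [h, sub_self, zero_add]
end

section
/- Let q : Λ → A be a quadratic form with polar form b, let α ∈ Λ and α̌ : Λ →ₗ[ℤ] ℤ satisfy α̌(α) = 2, and suppose q is s_α-invariant. If A has no 2-torsion (i.e. 2•a = 0 implies a = 0 for a ∈ A), then q satisfies the restricted condition at (α,α̌): b(α,λ) = α̌(λ)•q(α) for all λ ∈ Λ. In particular every s_α-invariant quadratic form with values in ℤ satisfies the restricted condition. -/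
/-- For a quadratic form `q : Λ → A` with polar form `b`, a pair `(α, av)`
with `av α = 2`, and `q` invariant under the reflection `s_α (λ) = λ - av λ • α`,
if `A` has no 2-torsion then the restricted condition holds:
`b(α,λ) = av λ • q α` for all `λ`. -/
theorem restricted_condition_of_reflection_invariant_of_two_torsion_free
    {Λ A : Type*} [AddCommGroup Λ] [AddCommGroup A]
    (q : QuadraticMap ℤ Λ A) (α : Λ) (av : Λ →ₗ[ℤ] ℤ) (hav : av α = 2)
    (hinv : ∀ l : Λ, q (l - av l • α) = q l)
    (hA : ∀ a : A, (2 : ℤ) • a = 0 → a = 0) :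
    ∀ l : Λ, QuadraticMap.polar ⇑q α l = av l • q α := by
  intro l
  have hb : QuadraticMap.polar q (-α) (l - av l • α) = QuadraticMap.polar q α l := by
    have hs : -α + (l - av l • α) = (α + l) - av (α + l) • α := by
      rw [map_add, hav]
      module
    rw [QuadraticMap.polar, QuadraticMap.polar, hs, hinv, hinv, QuadraticMap.map_neg]
  rw [QuadraticMap.polar_neg_left, QuadraticMap.polar_sub_right, QuadraticMap.polar_smul_right,
    QuadraticMap.polar_self] at hb
  refine sub_eq_zero.mp (hA _ ?_)
  calc (2 : ℤ) • (QuadraticMap.polar q α l - av l • q α)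
      = QuadraticMap.polar q α l - -(QuadraticMap.polar q α l - av l • (2 : ℤ) • q α) := by module
    _ = 0 := by
      rw [sub_eq_zero]
      simpa only [ofNat_smul_eq_nsmul] using hb.symm
end

section
/- Let Λ be a finitely generated free ℤ-module, let W be a group acting on Λ by ℤ-linear automorphisms, and let A be an abelian group. Write Quad(Λ,ℤ)^W for the ℤ-module of W-invariant quadratic forms Λ → ℤ. Then the canonical ℤ-linear map Quad(Λ,ℤ)^W ⊗_ℤ A → QuadraticMap ℤ Λ A, determined by sending q ⊗ a to the quadratic form λ ↦ q(λ)•a, is injective, and its image consists of W-invariant quadratic forms Λ → A. -/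
open TensorProduct

/-- The `ℤ`-submodule of `W`-invariant quadratic forms `Λ → ℤ`, where `W` acts on `Λ`
through a homomorphism `ρ : W →* (Λ ≃ₗ[ℤ] Λ)`. -/
def invariantQuad {Λ : Type*} [AddCommGroup Λ] {W : Type*} [Group W]
    (ρ : W →* (Λ ≃ₗ[ℤ] Λ)) : Submodule ℤ (QuadraticMap ℤ Λ ℤ) where
  carrier := {q | ∀ (w : W) (l : Λ), q (ρ w l) = q l}
  add_mem' := by
    intro q₁ q₂ h₁ h₂ w l
    simp only [QuadraticMap.add_apply]
    rw [h₁ w l, h₂ w l]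
  zero_mem' := by intro w l; simp
  smul_mem' := by
    intro c q hq w l
    simp only [QuadraticMap.smul_apply]
    rw [hq w l]

/-- An injective linear map over a PID into a finite module splits if its range is saturated. -/
theorem LinearMap.exists_comp_eq_id_of_saturated_range {R M N : Type*} [CommRing R] [IsDomain R]
    [IsPrincipalIdealRing R] [AddCommGroup M] [Module R M] [AddCommGroup N] [Module R N]
    [Module.Finite R N] (f : M →ₗ[R] N) (hf : Function.Injective f)
    (hsat : ∀ (r : R) (v : N), r ≠ 0 → r • v ∈ range f → v ∈ range f) :
    ∃ g : N →ₗ[R] M, g ∘ₗ f = id := by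
  have : Module.IsTorsionFree R (N ⧸ range f) := by
    refine Module.IsTorsionFree.of_smul_eq_zero fun r m h ↦ ?_
    induction m using Submodule.Quotient.induction_on with | _ v
    rw [← Submodule.Quotient.mk_smul, Submodule.Quotient.mk_eq_zero] at h
    rw [Submodule.Quotient.mk_eq_zero]
    exact or_iff_not_imp_left.mpr fun hr ↦ hsat r v hr h
  obtain ⟨s, hs⟩ := Module.projective_lifting_property (range f).mkQ id (range f).mkQ_surjective
  have hex : Function.Exact f (range f).mkQ := LinearMap.exact_map_mkQ_range f
  exact ((hex.split_tfae'.out 0 1 rfl rfl).mp ⟨hf, s, hs⟩).2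

namespace QuadraticMap

/-- The integer quadratic form `q / n`, for `q` with all values divisible by `n ≠ 0`. -/
theorem exists_smul_eq_of_forall_dvd {M : Type*} [AddCommGroup M] (q : QuadraticMap ℤ M ℤ)
    {n : ℤ} (hn : n ≠ 0) (h : ∀ x, n ∣ q x) : ∃ q' : QuadraticMap ℤ M ℤ, n • q' = q := by
  choose f hf using h
  have hpolar (x y : M) : n * polar f x y = polar q x y := by
    simp only [polar, hf]; ring
  refine ⟨ofPolar f (fun a x ↦ ?_) (fun x x' y ↦ ?_) (fun a x y ↦ ?_), ?_⟩
  · apply mul_left_cancel₀ hn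
    rw [← hf, q.map_smul, hf x, smul_eq_mul, smul_eq_mul]; ring
  · apply mul_left_cancel₀ hn
    rw [mul_add, hpolar, hpolar, hpolar, q.polar_add_left]
  · apply mul_left_cancel₀ hn
    rw [smul_eq_mul, mul_left_comm, hpolar, hpolar, q.polar_smul_left, smul_eq_mul]
  · ext x
    simp [hf x]

/-- Divisibility of the values of `q` can be tested on the vectors `b i` and `b i + b j`. -/
theorem dvd_of_forall_basis {ι R M : Type*} [CommRing R] [AddCommGroup M] [Module R M]
    (q : QuadraticMap R M R) (b : Module.Basis ι R M) {r : R} (h : ∀ i, r ∣ q (b i))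
    (h' : ∀ i j, r ∣ q (b i + b j)) (x : M) : r ∣ q x := by
  classical
  rw [← q.sum_repr_sq_add_sum_repr_mul_polar b x, Finsupp.linearCombination_apply]
  refine dvd_add (Finset.dvd_sum fun i _ ↦ (h i).mul_left _) (Finset.dvd_sum fun p _ ↦ ?_)
  induction p with | _ i j
  exact (((h' i j).sub (h i)).sub (h j)).mul_left _

/-- The linear map `q ⊗ a ↦ (x ↦ q x • a)` on a submodule of integer-valued quadratic forms. -/
noncomputable def tensorToQuadraticMap {M : Type*} [AddCommGroup M]
    (S : Submodule ℤ (QuadraticMap ℤ M ℤ)) (A : Type*) [AddCommGroup A] :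
    S ⊗[ℤ] A →ₗ[ℤ] QuadraticMap ℤ M A :=
  TensorProduct.lift <| LinearMap.mk₂ ℤ
    (fun q a ↦ (LinearMap.toSpanSingleton ℤ A a).compQuadraticMap (q : QuadraticMap ℤ M ℤ))
    (fun _ _ _ ↦ by ext; simp [add_smul])
    (fun _ _ _ ↦ by ext; exact mul_smul (_ : ℤ) (_ : ℤ) (_ : A))
    (fun _ _ _ ↦ by ext; simp)
    (fun c q a ↦ by ext x; exact smul_comm ((q : QuadraticMap ℤ M ℤ) x) c a)

theorem tensorToQuadraticMap_tmul {M : Type*} [AddCommGroup M]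
    (S : Submodule ℤ (QuadraticMap ℤ M ℤ)) {A : Type*} [AddCommGroup A] (q : S) (a : A) (x : M) :
    tensorToQuadraticMap S A (q ⊗ₜ a) x = (q : QuadraticMap ℤ M ℤ) x • a := by
  rfl

/-- A saturated submodule of integer-valued quadratic forms is determined, by a linear
interpolation formula, by the values of its members at finitely many points. -/
theorem exists_interpolation {M : Type*} [AddCommGroup M] [Module.Free ℤ M] [Module.Finite ℤ M]
    (S : Submodule ℤ (QuadraticMap ℤ M ℤ))
    (hS : ∀ (n : ℤ) (q : QuadraticMap ℤ M ℤ), n ≠ 0 → n • q ∈ S → q ∈ S) :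
    ∃ (n : ℕ) (p : Fin n → M) (s : Fin n → S),
      ∀ q : S, ∑ t, (q : QuadraticMap ℤ M ℤ) (p t) • s t = q := by
  let b := Module.Free.chooseBasis ℤ M
  let ι := Module.Free.ChooseBasisIndex ℤ M
  let e := Fintype.equivFin (ι ⊕ ι × ι)
  let p := (Sum.elim b fun ij ↦ b ij.1 + b ij.2) ∘ e.symm
  let f : S →ₗ[ℤ] (Fin (Fintype.card (ι ⊕ ι × ι)) → ℤ) :=
    { toFun q t := (q : QuadraticMap ℤ M ℤ) (p t)
      map_add' _ _ := rfl
      map_smul' _ _ := rfl }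
  have hdvd (n : ℤ) (q : S) (h : ∀ t, n ∣ f q t) (x : M) : n ∣ (q : QuadraticMap ℤ M ℤ) x :=
    dvd_of_forall_basis _ b (fun i ↦ by simpa [f, p] using h (e (.inl i)))
      (fun i j ↦ by simpa [f, p] using h (e (.inr (i, j)))) x
  have hf : Function.Injective f := by
    refine (injective_iff_map_eq_zero f).mpr fun q hq ↦ Subtype.ext <| QuadraticMap.ext fun x ↦ ?_
    exact zero_dvd_iff.mp (hdvd 0 q (fun t ↦ by simp [hq]) x)
  obtain ⟨g, hg⟩ := f.exists_comp_eq_id_of_saturated_range hf fun n v hn ⟨q, hq⟩ ↦ by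
    obtain ⟨q', hq'⟩ := exists_smul_eq_of_forall_dvd (q : QuadraticMap ℤ M ℤ) hn
      (hdvd n q fun t ↦ by simp [hq])
    refine ⟨⟨q', hS n q' hn (hq' ▸ q.2)⟩, smul_right_injective _ hn ?_⟩
    dsimp only
    rw [← hq, ← map_smul]
    exact congrArg f (Subtype.ext hq')
  refine ⟨_, p, fun t ↦ g fun i ↦ if t = i then 1 else 0, fun q ↦ ?_⟩
  have hq := LinearMap.congr_fun hg q
  rw [LinearMap.comp_apply, LinearMap.pi_apply_eq_sum_univ] at hq
  exact hq

theorem tensorToQuadraticMap_injective {M : Type*} [AddCommGroup M] [Module.Free ℤ M]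
    [Module.Finite ℤ M] (S : Submodule ℤ (QuadraticMap ℤ M ℤ))
    (hS : ∀ (n : ℤ) (q : QuadraticMap ℤ M ℤ), n ≠ 0 → n • q ∈ S → q ∈ S)
    (A : Type*) [AddCommGroup A] : Function.Injective (tensorToQuadraticMap S A) := by
  obtain ⟨n, p, s, h⟩ := exists_interpolation S hS
  refine Function.LeftInverse.injective (g := fun Q ↦ ∑ t, s t ⊗ₜ[ℤ] Q (p t)) fun x ↦ ?_
  induction x with
  | zero => simp
  | add x y hx hy => simp [TensorProduct.tmul_add, Finset.sum_add_distrib, hx, hy]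
  | tmul q a =>
    simp only [tensorToQuadraticMap_tmul, TensorProduct.tmul_smul, TensorProduct.smul_tmul']
    rw [← TensorProduct.sum_tmul, h]

end QuadraticMap

/-- For `Λ` a finitely generated free `ℤ`-module with an action of a group `W`
by `ℤ`-linear automorphisms, and `A` an abelian group, the canonical `ℤ`-linear map
`Quad(Λ,ℤ)^W ⊗_ℤ A → QuadraticMap ℤ Λ A`, determined by `q ⊗ a ↦ (λ ↦ q(λ) • a)`,
is injective and its image consists of `W`-invariant quadratic forms. -/
theorem invariantQuad_tensor_injective_and_invariant
    {Λ : Type*} [AddCommGroup Λ] [Module.Free ℤ Λ] [Module.Finite ℤ Λ]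
    {A : Type*} [AddCommGroup A] {W : Type*} [Group W] (ρ : W →* (Λ ≃ₗ[ℤ] Λ)) :
    ∃ Φ : (↥(invariantQuad ρ) ⊗[ℤ] A) →ₗ[ℤ] QuadraticMap ℤ Λ A,
      (∀ (q : ↥(invariantQuad ρ)) (a : A) (l : Λ),
        Φ (q ⊗ₜ[ℤ] a) l = ((q : QuadraticMap ℤ Λ ℤ) l) • a) ∧
      Function.Injective Φ ∧
      (∀ (x : ↥(invariantQuad ρ) ⊗[ℤ] A) (w : W) (l : Λ), Φ x (ρ w l) = Φ x l) := by
  refine ⟨QuadraticMap.tensorToQuadraticMap (invariantQuad ρ) A,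
    QuadraticMap.tensorToQuadraticMap_tmul _,
    QuadraticMap.tensorToQuadraticMap_injective (invariantQuad ρ) ?_ A, fun x w l ↦ ?_⟩
  · exact fun n q hn hq w l ↦ mul_left_cancel₀ hn (hq w l)
  · induction x with
    | zero => simp
    | add x y hx hy => simp [hx, hy]
    | tmul q a => rw [QuadraticMap.tensorToQuadraticMap_tmul,
        QuadraticMap.tensorToQuadraticMap_tmul, q.2 w l]
end

section
/- Let α ∈ Λ and α̌ : Λ →ₗ[ℤ] ℤ with α̌(α) = 2. Suppose q : Λ → A is given by q(λ) = Σ_{j∈J} q_j(λ)•a_j for a finite index set J, s_α-invariant quadratic forms q_j : Λ → ℤ, and elements a_j ∈ A. Then q is an s_α-invariant quadratic form on Λ with values in A and q satisfies the restricted condition at (α,α̌): b(α,λ) = α̌(λ)•q(α) for all λ ∈ Λ. (Thus the image of the canonical map Quad(Λ,ℤ)^W ⊗_ℤ A → Quad(Λ,A)^W belongs to the restricted forms.) -/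
/-- An integer-valued quadratic form invariant under the reflection `s_α` satisfies the restricted
condition at `(α, av)`. -/
theorem QuadraticMap.polar_eq_of_reflection_invariant
    {Λ : Type*} [AddCommGroup Λ] (α : Λ) (av : Λ →ₗ[ℤ] ℤ) (hav : av α = 2)
    (q : QuadraticMap ℤ Λ ℤ) (hinv : ∀ l : Λ, q (l - av l • α) = q l) (l : Λ) :
    QuadraticMap.polar q α l = av l * q α := by
  have hpolar : QuadraticMap.polar q (α - av α • α) (l - av l • α) =
      QuadraticMap.polar q α l := by
    have hadd : α - av α • α + (l - av l • α) = (α + l) - av (α + l) • α := by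
      rw [map_add, add_smul]
      abel
    simp only [QuadraticMap.polar, hadd, hinv]
  have hneg : α - av α • α = -α := by
    rw [hav, two_smul]
    abel
  rw [hneg, QuadraticMap.polar_neg_left, QuadraticMap.polar_sub_right,
    QuadraticMap.polar_smul_right, QuadraticMap.polar_self] at hpolar
  simp only [smul_eq_mul, nsmul_eq_mul, Nat.cast_ofNat] at hpolar
  linarith


/-- If `q(λ) = ∑_{j ∈ J} q_j(λ) • a_j` for a finite family of `s_α`-invariant
integer-valued quadratic forms `q_j` and elements `a_j ∈ A`, then `q` is an `s_α`-invariant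
quadratic form `Λ → A` which satisfies the restricted condition at `(α, av)`:
`b(α,λ) = av λ • q α` for all `λ`. -/
theorem restricted_condition_of_sum_of_invariant_integral_forms
    {Λ A : Type*} [AddCommGroup Λ] [AddCommGroup A]
    (α : Λ) (av : Λ →ₗ[ℤ] ℤ) (hav : av α = 2)
    {J : Type*} [Fintype J] (qj : J → QuadraticMap ℤ Λ ℤ) (a : J → A)
    (hinv : ∀ (j : J) (l : Λ), qj j (l - av l • α) = qj j l) :
    ∃ Q : QuadraticMap ℤ Λ A,
      (∀ l : Λ, Q l = ∑ j, qj j l • a j) ∧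
      (∀ l : Λ, Q (l - av l • α) = Q l) ∧
      (∀ l : Λ, QuadraticMap.polar ⇑Q α l = av l • Q α) := by
  have hQ : ∀ l : Λ, (∑ j, (LinearMap.toSpanSingleton ℤ A (a j)).compQuadraticMap (qj j)) l =
      ∑ j, qj j l • a j := fun l => by
    simp
  refine ⟨∑ j, (LinearMap.toSpanSingleton ℤ A (a j)).compQuadraticMap (qj j), hQ,
    fun l => by simp only [hQ, hinv], fun l => ?_⟩
  simp only [QuadraticMap.polar, hQ, ← Finset.sum_sub_distrib, ← sub_smul, Finset.smul_sum,
    smul_smul]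
  refine Finset.sum_congr rfl fun j _ => ?_
  rw [← QuadraticMap.polar_eq_of_reflection_invariant α av hav (qj j) (hinv j) l,
    QuadraticMap.polar]
end

section
/- Let q : Λ → A be a quadratic form with polar form b, and let (α, α̌) and (β, β̌) be two pairs consisting of an element of Λ and a ℤ-linear functional Λ → ℤ with α̌(α) = 2 and β̌(β) = 2, such that q satisfies the restricted condition at both (α,α̌) and (β,β̌). If q(α) and q(β) have finite additive orders n_α and n_β respectively, then n_α divides n_β·α̌(β) in ℤ. (This is the integrality underlying the fact that the modified roots and coroots α♯ = n_α•α, α̌♯ = α̌/n_α form a root datum.) -/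
/-- Let `q : Λ → A` be a quadratic form satisfying the restricted condition
at two pairs `(α, av)` and `(β, bv)` with `av α = 2` and `bv β = 2`.  If `q α` and `q β`
have finite additive orders `n_α` and `n_β`, then `n_α` divides `n_β * av β` in `ℤ`. -/
theorem addOrderOf_dvd_mul_pairing
    {Λ A : Type*} [AddCommGroup Λ] [AddCommGroup A]
    (q : QuadraticMap ℤ Λ A)
    (α : Λ) (av : Λ →ₗ[ℤ] ℤ) (hav : av α = 2)
    (β : Λ) (bv : Λ →ₗ[ℤ] ℤ) (hbv : bv β = 2)
    (hresα : ∀ l : Λ, QuadraticMap.polar ⇑q α l = av l • q α)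
    (hresβ : ∀ l : Λ, QuadraticMap.polar ⇑q β l = bv l • q β)
    (hordα : IsOfFinAddOrder (q α)) (hordβ : IsOfFinAddOrder (q β)) :
    (addOrderOf (q α) : ℤ) ∣ (addOrderOf (q β) : ℤ) * av β := by
  have pairing_symm : av β • q α = bv α • q β := by
    rw [← hresα, ← hresβ, QuadraticMap.polar_comm]
  rw [addOrderOf_dvd_iff_zsmul_eq_zero, mul_smul, pairing_symm, smul_comm, natCast_zsmul,
    addOrderOf_nsmul_eq_zero, smul_zero]
end

section
/- (Decomposition for groups of semisimple rank 1.) Let Λ' be a ℤ-module and set Λ = ℤ × Λ', α = (1,0), and α̌ the linear map (c,λ') ↦ 2c, so that s_α(c,λ') = (−c,λ'). Then the map q ↦ (q(α), q∘ι'), where ι' : Λ' → Λ is the inclusion λ' ↦ (0,λ'), is a bijection from the set of s_α-invariant quadratic forms q : Λ → A satisfying the restricted condition at (α,α̌) onto A × {quadratic forms Λ' → A}; its inverse sends (a, q') to the quadratic form (c,λ') ↦ c²•a + q'(λ'). -/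
/-- The condition that a quadratic form `q` on `ℤ × Λ'` is invariant under the reflection
`s_α (c, λ') = (-c, λ')` attached to `α = (1,0)`, `α̌ (c,λ') = 2c`, and satisfies the
restricted condition at `(α, α̌)`. -/
def IsInvariantRestricted {Λ' A : Type*} [AddCommGroup Λ'] [AddCommGroup A]
    (q : QuadraticMap ℤ (ℤ × Λ') A) : Prop :=
  (∀ p : ℤ × Λ', q (-p.1, p.2) = q p) ∧
  (∀ p : ℤ × Λ',
    QuadraticMap.polar ⇑q ((1 : ℤ), (0 : Λ')) p = (2 * p.1) • q ((1 : ℤ), (0 : Λ')))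

/-- The quadratic form `(c, λ') ↦ c² • a + q' λ'` on `ℤ × Λ'`. -/
def rankOneForm {Λ' A : Type*} [AddCommGroup Λ'] [AddCommGroup A]
    (a : A) (q' : QuadraticMap ℤ Λ' A) : QuadraticMap ℤ (ℤ × Λ') A :=
  (LinearMap.toSpanSingleton ℤ A a).compQuadraticMap
      ((QuadraticMap.sq (R := ℤ)).comp (LinearMap.fst ℤ ℤ Λ')) +
    q'.comp (LinearMap.snd ℤ ℤ Λ')

theorem rankOneForm_apply {Λ' A : Type*} [AddCommGroup Λ'] [AddCommGroup A]
    (a : A) (q' : QuadraticMap ℤ Λ' A) (p : ℤ × Λ') :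
    rankOneForm a q' p = (p.1 * p.1) • a + q' p.2 := by
  simp [rankOneForm]

theorem isInvariantRestricted_rankOneForm {Λ' A : Type*} [AddCommGroup Λ'] [AddCommGroup A]
    (a : A) (q' : QuadraticMap ℤ Λ' A) : IsInvariantRestricted (rankOneForm a q') := by
  refine ⟨fun p => by simp [rankOneForm_apply], fun p => ?_⟩
  simp only [QuadraticMap.polar, rankOneForm_apply, Prod.fst_add, Prod.snd_add, zero_add,
    QuadraticMap.map_zero]
  module

theorem IsInvariantRestricted.apply_eq {Λ' A : Type*} [AddCommGroup Λ'] [AddCommGroup A]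
    {q : QuadraticMap ℤ (ℤ × Λ') A} (hq : IsInvariantRestricted q) (p : ℤ × Λ') :
    q p = (p.1 * p.1) • q ((1 : ℤ), (0 : Λ')) + q ((0 : ℤ), p.2) := by
  have hp : p = p.1 • ((1 : ℤ), (0 : Λ')) + ((0 : ℤ), p.2) := by ext <;> simp
  conv_lhs => rw [hp]
  rw [QuadraticMap.map_add q, QuadraticMap.polar_smul_left, hq.2, QuadraticMap.map_smul]
  simp

/-- decomposition for groups of semisimple rank 1: For `Λ = ℤ × Λ'`,
`α = (1,0)` and `α̌ (c,λ') = 2c`, the map `q ↦ (q α, q ∘ ι')` is a bijection from the set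
of `s_α`-invariant quadratic forms satisfying the restricted condition at `(α, α̌)` onto
`A × {quadratic forms Λ' → A}`; its inverse sends `(a, q')` to
`(c, λ') ↦ c² • a + q' λ'`. -/
theorem rank_one_decomposition
    {Λ' A : Type*} [AddCommGroup Λ'] [AddCommGroup A] :
    Function.Bijective
      (fun q : {q : QuadraticMap ℤ (ℤ × Λ') A // IsInvariantRestricted q} =>
        (((q : QuadraticMap ℤ (ℤ × Λ') A) ((1 : ℤ), (0 : Λ'))),
          ((q : QuadraticMap ℤ (ℤ × Λ') A).comp (LinearMap.inr ℤ ℤ Λ')))) ∧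
    ∀ (q : {q : QuadraticMap ℤ (ℤ × Λ') A // IsInvariantRestricted q}) (p : ℤ × Λ'),
      (q : QuadraticMap ℤ (ℤ × Λ') A) p =
        (p.1 * p.1) • (q : QuadraticMap ℤ (ℤ × Λ') A) ((1 : ℤ), (0 : Λ')) +
          (q : QuadraticMap ℤ (ℤ × Λ') A) ((0 : ℤ), p.2) := by
  refine ⟨⟨fun q r h => ?_, fun ⟨a, q'⟩ => ?_⟩, fun q => q.2.apply_eq⟩
  · obtain ⟨h₁, h₂⟩ := Prod.ext_iff.mp h
    refine Subtype.ext (QuadraticMap.ext fun p => ?_)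
    have h₃ : q.1 (0, p.2) = r.1 (0, p.2) := DFunLike.congr_fun h₂ p.2
    rw [q.2.apply_eq, r.2.apply_eq, h₃]
    exact congrArg (fun a => (p.1 * p.1) • a + r.1 (0, p.2)) h₁
  · refine ⟨⟨rankOneForm a q', isInvariantRestricted_rankOneForm a q'⟩, Prod.ext ?_ ?_⟩
    · simp [rankOneForm_apply]
    · ext v
      simp [rankOneForm_apply]
end
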